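/- arXiv:1407.0676 — 2 statements merged into one kernel-verified Lean document; each statement's English description precedes it below -/
import Mathlib

section
/- Let (X,d_X) be a metric space and endow X×X with a metric d satisfying m₁ max(d_X,d_X) ≤ d ≤ m₂ max(d_X,d_X) for some constants 0 < m₁ ≤ m₂. Then for every set F ⊂ X, dim_A(F×F) = 2 dim_A F. -/
open Metric Set Filter
open scoped ENNReal NNReal

namespace Paper

noncomputable def coverNum {X : Type*} [MetricSpace X] (F : Set X) (r : ℝ) : ℝ≥0∞ :=
  ⨅ (s : Finset X) (_ : F ⊆ ⋃ x ∈ s, closedBall x r), (s.card : ℝ≥0∞)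

noncomputable def diamCoverNum {X : Type*} [MetricSpace X] (F : Set X) (r : ℝ) : ℝ≥0∞ :=
  ⨅ (U : Finset (Set X)) (_ : F ⊆ ⋃₀ ↑U)
    (_ : ∀ A ∈ U, EMetric.diam A ≤ ENNReal.ofReal r), (U.card : ℝ≥0∞)

noncomputable def lowerBoxDim {X : Type*} [MetricSpace X] (F : Set X) : ℝ :=
  Filter.liminf (fun r : ℝ => Real.log (coverNum F r).toReal / (-Real.log r))
    (nhdsWithin 0 (Set.Ioi 0))

noncomputable def upperBoxDim {X : Type*} [MetricSpace X] (F : Set X) : ℝ :=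
  Filter.limsup (fun r : ℝ => Real.log (coverNum F r).toReal / (-Real.log r))
    (nhdsWithin 0 (Set.Ioi 0))

def IsHomogeneous {X : Type*} [MetricSpace X] (F : Set X) (s : ℝ) : Prop :=
  ∀ δ₀ : ℝ, 0 < δ₀ → ∃ C : ℝ, 0 < C ∧
    ∀ x ∈ F, ∀ δ ρ : ℝ, 0 < ρ → ρ < δ → δ ≤ δ₀ →
      coverNum (closedBall x δ ∩ F) ρ ≤ ENNReal.ofReal (C * (δ / ρ) ^ s)

noncomputable def assouadDim {X : Type*} [MetricSpace X] (F : Set X) : EReal :=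
  sInf ((fun s : ℝ => (s : EReal)) '' {s : ℝ | 0 ≤ s ∧ IsHomogeneous F s})

def EquiHomogeneous {X : Type*} [MetricSpace X] (F : Set X) : Prop :=
  ∀ δ₀ : ℝ, 0 < δ₀ → ∃ M : ℝ≥0, 1 ≤ M ∧ ∃ c₁ c₂ : ℝ, 0 < c₁ ∧ 0 < c₂ ∧
    ∀ δ ρ : ℝ, 0 < ρ → ρ < δ → δ ≤ δ₀ →
      (⨆ x ∈ F, coverNum (closedBall x δ ∩ F) ρ) ≤
        (M : ℝ≥0∞) * ⨅ x ∈ F, coverNum (closedBall x (c₁ * δ) ∩ F) (c₂ * ρ)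

noncomputable def cantorLen (lam : ℕ → ℝ) (n : ℕ) : ℝ := ∏ i ∈ Finset.range n, lam i

noncomputable def cantorPre (lam : ℕ → ℝ) (n : ℕ) : Set ℝ :=
  ⋃ ε : ℕ → Bool,
    Set.Icc (∑ i ∈ Finset.range n, if ε i then cantorLen lam i - cantorLen lam (i + 1) else 0)
      ((∑ i ∈ Finset.range n, if ε i then cantorLen lam i - cantorLen lam (i + 1) else 0) +
        cantorLen lam n)

noncomputable def cantorSet (lam : ℕ → ℝ) : Set ℝ := ⋂ n : ℕ, cantorPre lam n

open Classical in
noncomputable def lamSeq (q : ℝ) (a : ℕ → ℕ) (i : ℕ) : ℝ :=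
  if h : ∃ k : ℕ, i + 1 = ∑ j ∈ Finset.range (k + 1), a (2 * j) then
    q ^ (a (2 * h.choose + 1) + 1)
  else q

open Classical in
noncomputable def muSeq (q : ℝ) (a : ℕ → ℕ) (i : ℕ) : ℝ :=
  if h : ∃ k : ℕ, i + 1 = a 0 + ∑ j ∈ Finset.range (k + 1), a (2 * j + 1) then
    q ^ (a (2 * h.choose + 2) + 1)
  else q

noncomputable def prodSetL2 (C D : Set ℝ) : Set (WithLp 2 (ℝ × ℝ)) :=
  (WithLp.equiv 2 (ℝ × ℝ)).symm '' (C ×ˢ D)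

lemma coverNum_le_card {X : Type*} [MetricSpace X] {F : Set X} {r : ℝ} {s : Finset X}
    (h : F ⊆ ⋃ x ∈ s, closedBall x r) : coverNum F r ≤ s.card :=
  iInf₂_le s h

lemma coverNum_mono {X : Type*} [MetricSpace X] {A B : Set X} (h : A ⊆ B) (r : ℝ) :
    coverNum A r ≤ coverNum B r :=
  le_iInf₂ fun _ hs => coverNum_le_card (h.trans hs)

lemma exists_card_eq_coverNum {X : Type*} [MetricSpace X] {F : Set X} {r : ℝ}
    (h : coverNum F r ≠ ⊤) :
    ∃ s : Finset X, F ⊆ ⋃ x ∈ s, closedBall x r ∧ (s.card : ℝ≥0∞) = coverNum F r := by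
  classical
  have hex : ∃ n : ℕ, ∃ s : Finset X, F ⊆ (⋃ x ∈ s, closedBall x r) ∧ s.card = n := by
    by_contra! hne
    refine h (iInf₂_eq_top.2 fun s hs => ?_)
    exact absurd rfl (hne s.card s hs)
  obtain ⟨s, hs, hcard⟩ := Nat.find_spec hex
  refine ⟨s, hs, le_antisymm (le_iInf₂ fun t ht => ?_) (coverNum_le_card hs)⟩
  rw [hcard]
  exact_mod_cast Nat.find_min' hex ⟨t, ht, rfl⟩

/-- A bound on the size of separated subsets bounds the covering number. -/
lemma coverNum_le_of_card_separated_le {X : Type*} [MetricSpace X] {A : Set X} {r : ℝ}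
    (hr : 0 ≤ r) {n : ℕ}
    (h : ∀ S : Finset X, (S : Set X) ⊆ A → (S : Set X).Pairwise (fun x y => r < dist x y) →
      S.card ≤ n) : coverNum A r ≤ n := by
  classical
  let P : ℕ → Prop := fun k => ∃ S : Finset X, (S : Set X) ⊆ A ∧
    (S : Set X).Pairwise (fun x y => r < dist x y) ∧ S.card = k
  have h0 : P 0 := ⟨∅, by simp, by simp, rfl⟩
  obtain ⟨S, hSA, hS, hcard⟩ : P (Nat.findGreatest P n) := Nat.findGreatest_spec (Nat.zero_le n) h0
  refine (coverNum_le_card (s := S) fun x hx => ?_).trans (by exact_mod_cast h S hSA hS)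
  simp only [mem_iUnion, mem_closedBall, exists_prop]
  by_contra! hfar
  have hxS : x ∉ S := fun hxS => absurd (hfar x hxS) (by simpa using hr)
  have hsub : ((insert x S : Finset X) : Set X) ⊆ A := by
    rw [Finset.coe_insert]
    exact insert_subset hx hSA
  have hsep : ((insert x S : Finset X) : Set X).Pairwise (fun x y => r < dist x y) := by
    rw [Finset.coe_insert]
    refine hS.insert fun y hy _ => ⟨hfar y hy, ?_⟩
    rw [dist_comm]
    exact hfar y hy
  have hle := Nat.le_findGreatest (P := P) (h _ hsub hsep) ⟨_, hsub, hsep, rfl⟩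
  rw [Finset.card_insert_of_notMem hxS] at hle
  omega

section Product

variable {X Z : Type*} [MetricSpace X] [MetricSpace Z] {m₁ m₂ : ℝ} {e : Z ≃ X × X}

lemma coverNum_preimage_prod_le
    (hd₂ : ∀ p q : Z, dist p q ≤ m₂ * max (dist (e p).1 (e q).1) (dist (e p).2 (e q).2))
    (hm₂ : 0 < m₂) {A B : Set X} {r : ℝ} (hA : coverNum A (r / m₂) ≠ ⊤)
    (hB : coverNum B (r / m₂) ≠ ⊤) :
    coverNum (e ⁻¹' (A ×ˢ B)) r ≤ coverNum A (r / m₂) * coverNum B (r / m₂) := by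
  obtain ⟨s, hs, hsc⟩ := exists_card_eq_coverNum hA
  obtain ⟨t, ht, htc⟩ := exists_card_eq_coverNum hB
  rw [← hsc, ← htc]
  refine (coverNum_le_card (s := (s ×ˢ t).map e.symm.toEmbedding) ?_).trans (by simp)
  rintro z ⟨hzA, hzB⟩
  obtain ⟨x, hx, hzx⟩ := mem_iUnion₂.1 (hs hzA)
  obtain ⟨y, hy, hzy⟩ := mem_iUnion₂.1 (ht hzB)
  refine mem_iUnion₂.2 ⟨e.symm (x, y), by simp [hx, hy], ?_⟩
  rw [mem_closedBall] at *
  refine (hd₂ _ _).trans ?_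
  rw [Equiv.apply_symm_apply, mul_comm, ← le_div_iff₀ hm₂]
  exact max_le hzx hzy

lemma coverNum_sq_le_coverNum_preimage_prod
    (hd₁ : ∀ p q : Z, m₁ * max (dist (e p).1 (e q).1) (dist (e p).2 (e q).2) ≤ dist p q)
    (hm₁ : 0 < m₁) (A : Set X) {r : ℝ} (hr : 0 ≤ r) :
    coverNum A r ^ 2 ≤ coverNum (e ⁻¹' (A ×ˢ A)) (m₁ * r / 2) := by
  refine le_iInf₂ fun T hT => ?_
  have key : coverNum A r ≤ (Nat.sqrt T.card : ℕ) := by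
    refine coverNum_le_of_card_separated_le hr fun S hSA hS => Nat.le_sqrt.2 ?_
    rw [← Finset.card_product]
    refine Finset.card_le_card_of_forall_subsingleton
      (fun p z => e.symm p ∈ closedBall z (m₁ * r / 2)) (fun p hp => ?_) ?_
    · rw [Finset.mem_product] at hp
      have := hT (a := e.symm p) (by simpa using ⟨hSA hp.1, hSA hp.2⟩)
      simpa using this
    rintro z - p ⟨hp, hpz⟩ q ⟨hq, hqz⟩
    have hdist : dist (e.symm p) (e.symm q) ≤ m₁ * r := by
      have h1 := mem_closedBall.1 hpz
      have h2 := mem_closedBall.1 hqz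
      linarith [dist_triangle_right (e.symm p) (e.symm q) z]
    have hmax := (hd₁ _ _).trans hdist
    rw [Equiv.apply_symm_apply, Equiv.apply_symm_apply, mul_le_mul_iff_right₀ hm₁,
      max_le_iff] at hmax
    rw [Finset.mem_product] at hp hq
    refine Prod.ext ?_ ?_
    · by_contra hne
      exact absurd (hS hp.1 hq.1 hne) hmax.1.not_gt
    · by_contra hne
      exact absurd (hS hp.2 hq.2 hne) hmax.2.not_gt
  calc coverNum A r ^ 2 ≤ (((Nat.sqrt T.card : ℕ) : ℝ≥0∞) ^ 2 : ℝ≥0∞) := by gcongr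
    _ ≤ T.card := mod_cast Nat.sqrt_le' T.card

lemma IsHomogeneous.preimage_prod
    (hd₁ : ∀ p q : Z, m₁ * max (dist (e p).1 (e q).1) (dist (e p).2 (e q).2) ≤ dist p q)
    (hd₂ : ∀ p q : Z, dist p q ≤ m₂ * max (dist (e p).1 (e q).1) (dist (e p).2 (e q).2))
    (hm₁ : 0 < m₁) (hm : m₁ ≤ m₂) {F : Set X} {s : ℝ} (hF : IsHomogeneous F s) :
    IsHomogeneous (e ⁻¹' (F ×ˢ F)) (2 * s) := by
  have hm₂ : 0 < m₂ := hm₁.trans_le hm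
  intro δ₀ hδ₀
  obtain ⟨C, hC, h⟩ := hF (δ₀ / m₁) (by positivity)
  refine ⟨C ^ 2 * (m₂ / m₁) ^ (2 * s), by positivity, ?_⟩
  rintro z ⟨hz₁, hz₂⟩ δ ρ hρ hρδ hδ
  have hδpos : 0 < δ := hρ.trans hρδ
  have hlt : ρ / m₂ < δ / m₁ := by
    calc ρ / m₂ < δ / m₂ := by gcongr
      _ ≤ δ / m₁ := by gcongr
  have hcov : ∀ x ∈ F, coverNum (closedBall x (δ / m₁) ∩ F) (ρ / m₂) ≤
      ENNReal.ofReal (C * (δ / m₁ / (ρ / m₂)) ^ s) := fun x hx =>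
    h x hx _ _ (by positivity) hlt (by gcongr)
  have hsub : closedBall z δ ∩ e ⁻¹' (F ×ˢ F) ⊆
      e ⁻¹' ((closedBall (e z).1 (δ / m₁) ∩ F) ×ˢ (closedBall (e z).2 (δ / m₁) ∩ F)) := by
    rintro w ⟨hw, hw₁, hw₂⟩
    have hmax := (hd₁ w z).trans (mem_closedBall.1 hw)
    rw [mul_comm, ← le_div_iff₀ hm₁, max_le_iff] at hmax
    exact ⟨⟨hmax.1, hw₁⟩, hmax.2, hw₂⟩
  calc coverNum (closedBall z δ ∩ e ⁻¹' (F ×ˢ F)) ρ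
      ≤ _ := coverNum_mono hsub ρ
    _ ≤ _ := coverNum_preimage_prod_le hd₂ hm₂
        ((hcov _ hz₁).trans_lt ENNReal.ofReal_lt_top).ne
        ((hcov _ hz₂).trans_lt ENNReal.ofReal_lt_top).ne
    _ ≤ _ := mul_le_mul' (hcov _ hz₁) (hcov _ hz₂)
    _ = ENNReal.ofReal (C ^ 2 * (m₂ / m₁) ^ (2 * s) * (δ / ρ) ^ (2 * s)) := by
        rw [← ENNReal.ofReal_mul (by positivity)]
        congr 1
        have hq : δ / m₁ / (ρ / m₂) = m₂ / m₁ * (δ / ρ) := by field_simp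
        rw [hq, Real.mul_rpow (by positivity) (by positivity), two_mul,
          Real.rpow_add (by positivity), Real.rpow_add (by positivity)]
        ring

lemma IsHomogeneous.of_preimage_prod
    (hd₁ : ∀ p q : Z, m₁ * max (dist (e p).1 (e q).1) (dist (e p).2 (e q).2) ≤ dist p q)
    (hd₂ : ∀ p q : Z, dist p q ≤ m₂ * max (dist (e p).1 (e q).1) (dist (e p).2 (e q).2))
    (hm₁ : 0 < m₁) (hm : m₁ ≤ m₂) {F : Set X} {t : ℝ}
    (hF : IsHomogeneous (e ⁻¹' (F ×ˢ F)) t) : IsHomogeneous F (t / 2) := by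
  have hm₂ : 0 < m₂ := hm₁.trans_le hm
  intro δ₀ hδ₀
  obtain ⟨C, hC, h⟩ := hF (m₂ * δ₀) (by positivity)
  refine ⟨(C * (2 * m₂ / m₁) ^ t) ^ (1 / 2 : ℝ), by positivity, ?_⟩
  intro x hx δ ρ hρ hρδ hδ
  have hδpos : 0 < δ := hρ.trans hρδ
  have hsub : e ⁻¹' ((closedBall x δ ∩ F) ×ˢ (closedBall x δ ∩ F)) ⊆
      closedBall (e.symm (x, x)) (m₂ * δ) ∩ e ⁻¹' (F ×ˢ F) := by
    rintro w ⟨⟨hw₁, hF₁⟩, hw₂, hF₂⟩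
    refine ⟨mem_closedBall.2 ((hd₂ _ _).trans ?_), hF₁, hF₂⟩
    rw [Equiv.apply_symm_apply]
    exact mul_le_mul_of_nonneg_left (max_le hw₁ hw₂) hm₂.le
  have hlt : m₁ * ρ / 2 < m₂ * δ := by
    calc m₁ * ρ / 2 < m₁ * ρ := half_lt_self (by positivity)
      _ ≤ m₂ * δ := by gcongr
  refine (ENNReal.pow_le_pow_left_iff two_ne_zero).1 ?_
  calc coverNum (closedBall x δ ∩ F) ρ ^ 2
      ≤ _ := coverNum_sq_le_coverNum_preimage_prod hd₁ hm₁ _ hρ.le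
    _ ≤ _ := coverNum_mono hsub _
    _ ≤ ENNReal.ofReal (C * (m₂ * δ / (m₁ * ρ / 2)) ^ t) :=
        h _ (by simpa using hx) _ _ (by positivity) hlt (by gcongr)
    _ = ENNReal.ofReal ((C * (2 * m₂ / m₁) ^ t) ^ (1 / 2 : ℝ) * (δ / ρ) ^ (t / 2)) ^ 2 := by
        rw [← ENNReal.ofReal_pow (by positivity)]
        congr 1
        have hq : m₂ * δ / (m₁ * ρ / 2) = 2 * m₂ / m₁ * (δ / ρ) := by field_simp
        rw [hq, Real.mul_rpow (by positivity) (by positivity), mul_pow,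
          ← Real.rpow_mul_natCast (by positivity), ← Real.rpow_mul_natCast (by positivity)]
        norm_num
        ring

lemma assouadDim_preimage_prod
    (hd₁ : ∀ p q : Z, m₁ * max (dist (e p).1 (e q).1) (dist (e p).2 (e q).2) ≤ dist p q)
    (hd₂ : ∀ p q : Z, dist p q ≤ m₂ * max (dist (e p).1 (e q).1) (dist (e p).2 (e q).2))
    (hm₁ : 0 < m₁) (hm : m₁ ≤ m₂) (F : Set X) :
    assouadDim (e ⁻¹' (F ×ˢ F)) = 2 * assouadDim F := by
  have h2 : (0 : EReal) < 2 := by norm_num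
  have h2top : (2 : EReal) ≠ ⊤ := EReal.coe_ne_top 2
  apply le_antisymm
  · rw [← EReal.div_le_iff_le_mul h2 h2top]
    refine le_sInf ?_
    rintro _ ⟨s, ⟨hs, hF⟩, rfl⟩
    rw [EReal.div_le_iff_le_mul h2 h2top]
    refine sInf_le ⟨2 * s, ⟨by positivity, hF.preimage_prod hd₁ hd₂ hm₁ hm⟩, ?_⟩
    rfl
  · refine le_sInf ?_
    rintro _ ⟨t, ⟨ht, hF⟩, rfl⟩
    rw [mul_comm, ← EReal.le_div_iff_mul_le h2 h2top]
    exact sInf_le ⟨t / 2, ⟨by positivity, hF.of_preimage_prod hd₁ hd₂ hm₁ hm⟩, rfl⟩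

end Product

theorem statement3 {X : Type*} [MetricSpace X]
    (dZ : MetricSpace (X × X)) (m₁ m₂ : ℝ) (hm₁ : 0 < m₁) (hm : m₁ ≤ m₂)
    (hd₁ : ∀ p q : X × X,
      m₁ * max (dist p.1 q.1) (dist p.2 q.2) ≤ @dist _ dZ.toPseudoMetricSpace.toDist p q)
    (hd₂ : ∀ p q : X × X,
      @dist _ dZ.toPseudoMetricSpace.toDist p q ≤ m₂ * max (dist p.1 q.1) (dist p.2 q.2))
    (F : Set X) :
    @assouadDim _ dZ (F ×ˢ F) = 2 * assouadDim F :=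
  @assouadDim_preimage_prod X (X × X) _ dZ m₁ m₂ (Equiv.refl _) hd₁ hd₂ hm₁ hm F

end Paper
end

section
/- Let C be the generalised Cantor set generated by a sequence (λ_i) with λ_i ∈ (0,1/2). Then the lower and upper box-counting dimensions of C satisfy dim_LB C = liminf_{n→∞} (n log 2)/(−Σ_{i=1}^n log λ_i) and dim_B C = limsup_{n→∞} (n log 2)/(−Σ_{i=1}^n log λ_i). -/
open Metric Set Filter
open scoped ENNReal NNReal

namespace Paper

theorem limsup_le_limsup_of_le_comp_add {α β : Type*} {F : Filter α} {G : Filter β}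
    {f e : α → ℝ} {g : β → ℝ} {φ : α → β} (hφ : Tendsto φ F G) (he : Tendsto e F (nhds 0))
    (hfg : ∀ᶠ x in F, f x ≤ g (φ x) + e x)
    (hg : G.IsBoundedUnder (· ≤ ·) g) (hf : F.IsCoboundedUnder (· ≤ ·) f) :
    limsup f F ≤ limsup g G := by
  refine le_of_forall_gt_imp_ge_of_dense fun c hc => ?_
  obtain ⟨c', hc', hc'c⟩ := exists_between hc
  have h1 := hφ.eventually (eventually_lt_of_limsup_lt hc' hg)
  have h2 := he.eventually (gt_mem_nhds (sub_pos.2 hc'c))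
  refine limsup_le_of_le hf ?_
  filter_upwards [h1, h2, hfg] with x h1 h2 h3
  linarith

theorem liminf_le_liminf_of_comp_sub_le {α β : Type*} {F : Filter α} {G : Filter β}
    {f e : α → ℝ} {g : β → ℝ} {φ : α → β} (hφ : Tendsto φ F G) (he : Tendsto e F (nhds 0))
    (hfg : ∀ᶠ x in F, g (φ x) - e x ≤ f x)
    (hg : G.IsBoundedUnder (· ≥ ·) g) (hf : F.IsCoboundedUnder (· ≥ ·) f) :
    liminf g G ≤ liminf f F := by
  refine le_of_forall_lt_imp_le_of_dense fun c hc => ?_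
  obtain ⟨c', hcc', hc'⟩ := exists_between hc
  have h1 := hφ.eventually (eventually_lt_of_lt_liminf hc' hg)
  have h2 := he.eventually (gt_mem_nhds (sub_pos.2 hcc'))
  refine le_liminf_of_le hf ?_
  filter_upwards [h1, h2, hfg] with x h1 h2 h3
  linarith

/-- The left endpoint of the `n`-th level interval of the Cantor construction with address `ε`. -/
noncomputable def cantorLeft (lam : ℕ → ℝ) (n : ℕ) (ε : ℕ → Bool) : ℝ :=
  ∑ i ∈ Finset.range n, if ε i then cantorLen lam i - cantorLen lam (i + 1) else 0

section

variable {lam : ℕ → ℝ}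

theorem cantorLen_zero : cantorLen lam 0 = 1 := by simp [cantorLen]

theorem cantorLen_succ (n : ℕ) : cantorLen lam (n + 1) = cantorLen lam n * lam n := by
  simp [cantorLen, Finset.prod_range_succ]

theorem cantorLen_pos (hlam : ∀ i, lam i ∈ Ioo (0 : ℝ) (1 / 2)) (n : ℕ) :
    0 < cantorLen lam n :=
  Finset.prod_pos fun i _ => (hlam i).1

theorem two_mul_cantorLen_succ_lt (hlam : ∀ i, lam i ∈ Ioo (0 : ℝ) (1 / 2)) (n : ℕ) :
    2 * cantorLen lam (n + 1) < cantorLen lam n := by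
  rw [cantorLen_succ]
  nlinarith [cantorLen_pos hlam n, (hlam n).2]

theorem cantorLen_strictAnti (hlam : ∀ i, lam i ∈ Ioo (0 : ℝ) (1 / 2)) :
    StrictAnti (cantorLen lam) :=
  strictAnti_nat_of_succ_lt fun n => by
    linarith [two_mul_cantorLen_succ_lt hlam n, cantorLen_pos hlam (n + 1)]

theorem cantorLen_le_pow (hlam : ∀ i, lam i ∈ Ioo (0 : ℝ) (1 / 2)) (n : ℕ) :
    cantorLen lam n ≤ (1 / 2) ^ n := by
  induction n with
  | zero => simp [cantorLen]
  | succ n ih =>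
    rw [pow_succ]
    linarith [two_mul_cantorLen_succ_lt hlam n]

theorem tendsto_cantorLen (hlam : ∀ i, lam i ∈ Ioo (0 : ℝ) (1 / 2)) :
    Tendsto (cantorLen lam) atTop (nhds 0) :=
  squeeze_zero (fun n => (cantorLen_pos hlam n).le) (cantorLen_le_pow hlam)
    (tendsto_pow_atTop_nhds_zero_of_lt_one (by norm_num) (by norm_num))

theorem cantorLeft_succ (n : ℕ) (ε : ℕ → Bool) : cantorLeft lam (n + 1) ε =
    cantorLeft lam n ε + if ε n then cantorLen lam n - cantorLen lam (n + 1) else 0 :=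
  Finset.sum_range_succ _ _

theorem cantorLeft_monotone (hlam : ∀ i, lam i ∈ Ioo (0 : ℝ) (1 / 2)) (ε : ℕ → Bool) :
    Monotone fun n => cantorLeft lam n ε :=
  monotone_nat_of_le_succ fun n => by
    rw [cantorLeft_succ]
    split_ifs
    · linarith [cantorLen_strictAnti hlam n.lt_succ_self]
    · simp

theorem cantorLeft_add_cantorLen_antitone (hlam : ∀ i, lam i ∈ Ioo (0 : ℝ) (1 / 2))
    (ε : ℕ → Bool) : Antitone fun n => cantorLeft lam n ε + cantorLen lam n :=
  antitone_nat_of_succ_le fun n => by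
    rw [cantorLeft_succ]
    split_ifs
    · linarith
    · linarith [cantorLen_strictAnti hlam n.lt_succ_self]

theorem cantorLeft_mem_cantorSet (hlam : ∀ i, lam i ∈ Ioo (0 : ℝ) (1 / 2)) (n : ℕ)
    {ε : ℕ → Bool} (hε : ∀ i, n ≤ i → ε i = false) : cantorLeft lam n ε ∈ cantorSet lam := by
  refine mem_iInter.2 fun m => mem_iUnion.2 ⟨ε, ?_⟩
  have hstable : ∀ k, n ≤ k → cantorLeft lam k ε = cantorLeft lam n ε := fun k hk => by
    induction k, hk using Nat.le_induction with
    | base => rfl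
    | succ k hk ih => rw [cantorLeft_succ, hε k hk, ih]; simp
  rw [← hstable (max n m) (le_max_left _ _)]
  refine ⟨cantorLeft_monotone hlam ε (le_max_right n m), ?_⟩
  have h := cantorLeft_add_cantorLen_antitone hlam ε (le_max_right n m)
  exact (le_add_of_nonneg_right (cantorLen_pos hlam _).le).trans h

theorem cantorLen_le_cantorLeft_sub (hlam : ∀ i, lam i ∈ Ioo (0 : ℝ) (1 / 2)) {n k : ℕ}
    {ε η : ℕ → Bool} (hk : k < n) (heq : ∀ i < k, ε i = η i) (hε : ε k = true)
    (hη : η k = false) : cantorLen lam n ≤ cantorLeft lam n ε - cantorLeft lam n η := by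
  have h1 : cantorLeft lam k ε = cantorLeft lam k η :=
    Finset.sum_congr rfl fun i hi => by rw [heq i (Finset.mem_range.1 hi)]
  have h2 := cantorLeft_monotone hlam ε (Nat.succ_le_of_lt hk)
  have h3 := cantorLeft_add_cantorLen_antitone hlam η (Nat.succ_le_of_lt hk)
  simp only [Nat.succ_eq_add_one, cantorLeft_succ, hε, hη, if_true] at h2 h3
  have h4 := two_mul_cantorLen_succ_lt hlam k
  simp only [Bool.false_eq_true, if_false] at h3
  linarith

theorem cantorLen_le_abs_cantorLeft_sub (hlam : ∀ i, lam i ∈ Ioo (0 : ℝ) (1 / 2)) {n : ℕ}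
    {ε η : ℕ → Bool} (h : ∃ i < n, ε i ≠ η i) :
    cantorLen lam n ≤ |cantorLeft lam n ε - cantorLeft lam n η| := by
  classical
  have h' : ∃ i, ε i ≠ η i := h.imp fun _ => And.right
  have hlt : Nat.find h' < n := by
    obtain ⟨i, hi, hne⟩ := h
    exact (Nat.find_min' h' hne).trans_lt hi
  have heq : ∀ i < Nat.find h', ε i = η i := fun i hi => not_not.1 (Nat.find_min h' hi)
  have hne := Nat.find_spec h'
  cases hε : ε (Nat.find h') <;> cases hη : η (Nat.find h') <;> simp only [hε, hη] at hne
  · exact absurd rfl hne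
  · rw [abs_sub_comm]
    exact (cantorLen_le_cantorLeft_sub hlam hlt (fun i hi => (heq i hi).symm) hη hε).trans
      (le_abs_self _)
  · exact (cantorLen_le_cantorLeft_sub hlam hlt heq hε hη).trans (le_abs_self _)
  · exact absurd rfl hne

theorem coverNum_cantorSet_le {n : ℕ} {r : ℝ} (hr : cantorLen lam n ≤ r) :
    coverNum (cantorSet lam) r ≤ 2 ^ n := by
  classical
  let c : Finset ℕ → ℝ := fun S => cantorLeft lam n fun i => decide (i ∈ S)
  refine (iInf₂_le ((Finset.range n).powerset.image c) fun x hx => ?_).trans ?_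
  · obtain ⟨ε, hε⟩ := mem_iUnion.1 (mem_iInter.1 hx n)
    refine mem_iUnion₂.2 ⟨c ((Finset.range n).filter fun i => ε i = true),
      Finset.mem_image_of_mem _ (Finset.mem_powerset.2 (Finset.filter_subset _ _)), ?_⟩
    have hc : c ((Finset.range n).filter fun i => ε i = true) = cantorLeft lam n ε :=
      Finset.sum_congr rfl fun i hi => by simp [Finset.mem_range.1 hi]
    rw [hc, mem_closedBall, Real.dist_eq, abs_le]
    have h1 : cantorLeft lam n ε ≤ x := hε.1
    have h2 : x ≤ cantorLeft lam n ε + cantorLen lam n := hε.2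
    constructor <;> linarith
  · have h : ((Finset.range n).powerset.image c).card ≤ 2 ^ n :=
      Finset.card_image_le.trans_eq (by simp)
    exact_mod_cast h

theorem le_coverNum_cantorSet (hlam : ∀ i, lam i ∈ Ioo (0 : ℝ) (1 / 2)) {n : ℕ} {r : ℝ}
    (hr : 2 * r < cantorLen lam n) : 2 ^ n ≤ coverNum (cantorSet lam) r := by
  classical
  refine le_iInf₂ fun s hs => ?_
  let c : Finset ℕ → ℝ := fun S => cantorLeft lam n fun i => decide (i ∈ S)
  have hmem : ∀ S ∈ (Finset.range n).powerset, ∃ y ∈ s, c S ∈ closedBall y r := fun S hS => by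
    have hcS : c S ∈ cantorSet lam := cantorLeft_mem_cantorSet hlam n fun i hi => by
      simp only [decide_eq_false_iff_not]
      intro hiS
      have := Finset.mem_range.1 (Finset.mem_powerset.1 hS hiS)
      omega
    simpa using hs hcS
  choose! p hps hp using hmem
  have hinj : Set.InjOn p (Finset.range n).powerset := fun S hS T hT hST => by
    by_contra hne
    have hex : ∃ i < n, decide (i ∈ S) ≠ decide (i ∈ T) := by
      by_contra! hall
      refine hne (Finset.ext fun i => ?_)
      by_cases hi : i < n
      · exact decide_eq_decide.1 (hall i hi)
      · have hi' : i ∉ Finset.range n := by simpa using hi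
        exact iff_of_false (fun h => hi' (Finset.mem_powerset.1 hS h))
          fun h => hi' (Finset.mem_powerset.1 hT h)
    have h1 : cantorLen lam n ≤ |c S - c T| := cantorLen_le_abs_cantorLeft_sub hlam hex
    have h2 := mem_closedBall.1 (hp S hS)
    have h3 := mem_closedBall'.1 (hp T hT)
    rw [← hST] at h3
    have h4 := dist_triangle (c S) (p S) (c T)
    rw [Real.dist_eq (c S) (c T)] at h4
    linarith
  have h := Finset.card_le_card_of_injOn p (fun S hS => hps S hS) hinj
  rw [Finset.card_powerset, Finset.card_range] at h
  exact_mod_cast h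

theorem log_coverNum_cantorSet_le {n : ℕ} {r : ℝ} (hr : cantorLen lam n ≤ r) :
    Real.log (coverNum (cantorSet lam) r).toReal ≤ n * Real.log 2 := by
  have h := ENNReal.toReal_mono (by simp) (coverNum_cantorSet_le hr)
  rw [ENNReal.toReal_pow, ENNReal.toReal_ofNat] at h
  rcases ENNReal.toReal_nonneg.eq_or_lt with h0 | h0
  · rw [← h0, Real.log_zero]
    positivity
  · rw [← Real.log_pow]
    exact Real.log_le_log h0 h

theorem le_log_coverNum_cantorSet (hlam : ∀ i, lam i ∈ Ioo (0 : ℝ) (1 / 2)) {n : ℕ} {r : ℝ}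
    (hr0 : 0 < r) (hr : 2 * r < cantorLen lam n) :
    n * Real.log 2 ≤ Real.log (coverNum (cantorSet lam) r).toReal := by
  obtain ⟨m, hm⟩ := ((tendsto_cantorLen hlam).eventually (gt_mem_nhds hr0)).exists
  have hfin : coverNum (cantorSet lam) r ≠ ⊤ :=
    ne_top_of_le_ne_top (by simp) (coverNum_cantorSet_le hm.le)
  have h := ENNReal.toReal_mono hfin (le_coverNum_cantorSet hlam hr)
  rw [ENNReal.toReal_pow, ENNReal.toReal_ofNat] at h
  rw [← Real.log_pow]
  exact Real.log_le_log (by positivity) h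

theorem log_cantorLen (hlam : ∀ i, lam i ∈ Ioo (0 : ℝ) (1 / 2)) (n : ℕ) :
    Real.log (cantorLen lam n) = ∑ i ∈ Finset.range n, Real.log (lam i) :=
  Real.log_prod fun i _ => (hlam i).1.ne'

theorem mul_log_two_le_neg_log_cantorLen (hlam : ∀ i, lam i ∈ Ioo (0 : ℝ) (1 / 2)) (n : ℕ) :
    n * Real.log 2 ≤ -Real.log (cantorLen lam n) := by
  have h := Real.log_le_log (cantorLen_pos hlam n) (cantorLen_le_pow hlam n)
  rw [Real.log_pow, one_div, Real.log_inv] at h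
  linarith

theorem exists_cantorLen_succ_le_and_lt (hlam : ∀ i, lam i ∈ Ioo (0 : ℝ) (1 / 2)) {r : ℝ}
    (hr0 : 0 < r) (hr1 : r < 1) : ∃ n, cantorLen lam (n + 1) ≤ r ∧ r < cantorLen lam n := by
  classical
  have h : ∃ n, cantorLen lam n ≤ r :=
    ((tendsto_cantorLen hlam).eventually (gt_mem_nhds hr0)).exists.imp fun _ => le_of_lt
  have h0 : Nat.find h ≠ 0 := fun h0 => by
    have := Nat.find_spec h
    rw [h0, cantorLen_zero] at this
    linarith
  obtain ⟨n, hn⟩ := Nat.exists_eq_succ_of_ne_zero h0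
  have hle := Nat.find_spec h
  rw [hn] at hle
  exact ⟨n, hle, not_le.1 (Nat.find_min h (by omega))⟩

end

theorem statement9 (lam : ℕ → ℝ) (hlam : ∀ i, lam i ∈ Set.Ioo (0 : ℝ) (1 / 2)) :
    lowerBoxDim (cantorSet lam) =
      Filter.liminf
        (fun n : ℕ => (n * Real.log 2) / (-(∑ i ∈ Finset.range n, Real.log (lam i))))
        Filter.atTop ∧
      upperBoxDim (cantorSet lam) =
        Filter.limsup
          (fun n : ℕ => (n * Real.log 2) / (-(∑ i ∈ Finset.range n, Real.log (lam i))))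
          Filter.atTop := by
  set a : ℕ → ℝ := fun n => (n * Real.log 2) / (-(∑ i ∈ Finset.range n, Real.log (lam i)))
    with ha_def
  set f : ℝ → ℝ := fun r => Real.log (coverNum (cantorSet lam) r).toReal / (-Real.log r)
    with hf_def
  set e : ℕ → ℝ := fun n => 2 * Real.log 2 / (-Real.log (cantorLen lam n)) with he_def
  have hlog2 : 0 < Real.log 2 := Real.log_pos one_lt_two
  have ha : ∀ n, a n = n * Real.log 2 / (-Real.log (cantorLen lam n)) := fun n => by
    rw [log_cantorLen hlam]
  have hpos : ∀ n, 1 ≤ n → 0 < -Real.log (cantorLen lam n) := fun n hn => by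
    have hn' : (0 : ℝ) < n := by exact_mod_cast hn
    exact (mul_pos hn' hlog2).trans_le (mul_log_two_le_neg_log_cantorLen hlam n)
  have hnonneg : ∀ n, 0 ≤ -Real.log (cantorLen lam n) := fun n =>
    (by positivity : (0 : ℝ) ≤ n * Real.log 2).trans (mul_log_two_le_neg_log_cantorLen hlam n)
  have he : Tendsto e atTop (nhds 0) :=
    (tendsto_atTop_mono (mul_log_two_le_neg_log_cantorLen hlam)
      (tendsto_natCast_atTop_atTop.atTop_mul_const hlog2)).const_div_atTop _
  have ha0 : ∀ n, 0 ≤ a n := fun n => by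
    rw [ha]
    exact div_nonneg (by positivity) (hnonneg n)
  have ha1 : ∀ n, a n ≤ 1 := fun n => by
    rw [ha]
    exact div_le_one_of_le₀ (mul_log_two_le_neg_log_cantorLen hlam n) (hnonneg n)
  have hex : ∀ r, ∃ n, r ∈ Ioo (0 : ℝ) 1 → cantorLen lam (n + 1) ≤ r ∧ r < cantorLen lam n :=
    fun r => by
      by_cases hr : r ∈ Ioo (0 : ℝ) 1
      · exact (exists_cantorLen_succ_le_and_lt hlam hr.1 hr.2).imp fun _ h _ => h
      · exact ⟨0, fun h => absurd h hr⟩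
  choose u hu using hex
  have hunit : ∀ᶠ r in nhdsWithin (0 : ℝ) (Ioi 0), r ∈ Ioo (0 : ℝ) 1 :=
    Ioo_mem_nhdsGT one_pos
  have hu_top : Tendsto u (nhdsWithin 0 (Ioi 0)) atTop := by
    refine tendsto_atTop.2 fun m => ?_
    filter_upwards [hunit, Ioo_mem_nhdsGT (cantorLen_pos hlam m)] with r hr hrm
    have := (cantorLen_strictAnti hlam).lt_iff_gt.1 ((hu r hr).1.trans_lt hrm.2)
    omega
  have hf_le : ∀ᶠ r in nhdsWithin (0 : ℝ) (Ioi 0), f r ≤ a (u r) + e (u r) := by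
    filter_upwards [hunit, hu_top.eventually_ge_atTop 1] with r hr hur
    obtain ⟨h1, h2⟩ := hu r hr
    have h3 := log_coverNum_cantorSet_le h1
    have h4 := Real.log_lt_log hr.1 h2
    rw [ha, ← add_div]
    refine div_le_div₀ (by positivity) ?_ (hpos _ hur) (by linarith)
    push_cast at h3
    linarith
  have hle_f : ∀ᶠ r in nhdsWithin (0 : ℝ) (Ioi 0), a (u r + 1) - e (u r + 1) ≤ f r := by
    filter_upwards [hunit, hu_top.eventually_ge_atTop 1] with r hr hur
    obtain ⟨h1, h2⟩ := hu r hr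
    obtain ⟨m, hm⟩ := Nat.exists_eq_add_of_le' hur
    rw [hm] at h1 h2 ⊢
    have h3 := le_log_coverNum_cantorSet hlam hr.1
      ((mul_lt_mul_of_pos_left h2 two_pos).trans (two_mul_cantorLen_succ_lt hlam m))
    have h4 := Real.log_le_log (cantorLen_pos hlam _) h1
    have h5 : 0 < -Real.log r := neg_pos.2 (Real.log_neg hr.1 hr.2)
    rw [ha, ← sub_div]
    have h6 : ((m + 1 + 1 : ℕ) : ℝ) * Real.log 2 - 2 * Real.log 2 = m * Real.log 2 := by
      push_cast
      ring
    rw [h6]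
    exact div_le_div₀ ((by positivity : (0 : ℝ) ≤ m * Real.log 2).trans h3) h3 h5 (by linarith)
  have hL : Tendsto (cantorLen lam) atTop (nhdsWithin 0 (Ioi 0)) :=
    tendsto_nhdsWithin_iff.2
      ⟨tendsto_cantorLen hlam, Eventually.of_forall fun n => cantorLen_pos hlam n⟩
  have hfL_le : ∀ᶠ n in atTop, f (cantorLen lam n) - e n ≤ a n :=
    Eventually.of_forall fun n => by
      have h1 : f (cantorLen lam n) ≤ a n := by
        rw [ha]
        exact div_le_div_of_nonneg_right (log_coverNum_cantorSet_le le_rfl) (hnonneg n)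
      have h2 : 0 ≤ e n := div_nonneg (by positivity) (hnonneg n)
      linarith
  have hle_fL : ∀ᶠ n in atTop, a n ≤ f (cantorLen lam n) + e n := by
    filter_upwards [eventually_ge_atTop 1] with n hn
    obtain ⟨m, rfl⟩ := Nat.exists_eq_add_of_le' hn
    have h1 := le_log_coverNum_cantorSet hlam (cantorLen_pos hlam (m + 1))
      (two_mul_cantorLen_succ_lt hlam m)
    rw [ha, ← add_div]
    refine div_le_div_of_nonneg_right ?_ (hnonneg _)
    push_cast
    linarith
  have hef : Tendsto (fun r => e (u r)) (nhdsWithin 0 (Ioi 0)) (nhds 0) := he.comp hu_top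
  have hu_top' : Tendsto (fun r => u r + 1) (nhdsWithin 0 (Ioi 0)) atTop :=
    (tendsto_add_atTop_nat 1).comp hu_top
  have hef' : Tendsto (fun r => e (u r + 1)) (nhdsWithin 0 (Ioi 0)) (nhds 0) := he.comp hu_top'
  have ha_above : atTop.IsBoundedUnder (· ≤ ·) a := isBoundedUnder_of ⟨1, ha1⟩
  have ha_below : atTop.IsBoundedUnder (· ≥ ·) a := isBoundedUnder_of ⟨0, ha0⟩
  have hf_above : (nhdsWithin (0 : ℝ) (Ioi 0)).IsBoundedUnder (· ≤ ·) f := by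
    refine isBoundedUnder_of_eventually_le (a := 2) ?_
    filter_upwards [hf_le, hef.eventually (gt_mem_nhds one_pos)] with r h1 h2
    linarith [ha1 (u r)]
  have hf_below : (nhdsWithin (0 : ℝ) (Ioi 0)).IsBoundedUnder (· ≥ ·) f := by
    refine isBoundedUnder_of_eventually_ge (a := -1) ?_
    filter_upwards [hle_f, hef'.eventually (gt_mem_nhds one_pos)] with r h1 h2
    linarith [ha0 (u r + 1)]
  exact ⟨le_antisymm
      (liminf_le_liminf_of_comp_sub_le hL he hfL_le hf_below ha_above.isCoboundedUnder_ge)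
      (liminf_le_liminf_of_comp_sub_le hu_top' hef' hle_f ha_below hf_above.isCoboundedUnder_ge),
    le_antisymm
      (limsup_le_limsup_of_le_comp_add hu_top hef hf_le ha_above hf_below.isCoboundedUnder_le)
      (limsup_le_limsup_of_le_comp_add hL he hle_fL hf_above ha_below.isCoboundedUnder_le)⟩

end Paper
end
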